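/- Let λ > 0 and y ∈ ℝ^N with ‖y‖_∞ > λ. Let z = prox_{ℓ1}(y; λ) be the soft-thresholding of y, i.e., z_i = sign(y_i)·max(|y_i| − λ, 0) (note z ≠ 0 since ‖y‖_∞ > λ). Then c* = z (‖z‖₂ + λ)/‖z‖₂ is an optimal solution of min_c λ(‖c‖₁ − ‖c‖₂) + (1/2)‖c − y‖₂², i.e., c* is a proximal point of the ℓ₁−ℓ₂ functional at y with parameter λ. -/

import Mathlib

/-- The Euclidean (ℓ²) norm of a vector in `ℝ^N`. -/
noncomputable def euclNorm {N : ℕ} (x : Fin N → ℝ) : ℝ := Real.sqrt (∑ i, x i ^ 2)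

theorem euclNorm_nonneg {N : ℕ} (x : Fin N → ℝ) : 0 ≤ euclNorm x := Real.sqrt_nonneg _

theorem euclNorm_sq {N : ℕ} (x : Fin N → ℝ) : euclNorm x ^ 2 = ∑ i, x i ^ 2 :=
  Real.sq_sqrt (Finset.sum_nonneg fun _ _ => sq_nonneg _)

theorem euclNorm_smul {N : ℕ} {k : ℝ} (hk : 0 ≤ k) (x : Fin N → ℝ) :
    euclNorm (k • x) = k * euclNorm x := by
  refine (sq_eq_sq₀ (euclNorm_nonneg _) (mul_nonneg hk (euclNorm_nonneg _))).1 ?_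
  rw [mul_pow, euclNorm_sq, euclNorm_sq, Finset.mul_sum]
  exact Finset.sum_congr rfl fun i _ => by simp [mul_pow]

theorem euclNorm_sub_sq {N : ℕ} (x y : Fin N → ℝ) :
    euclNorm (x - y) ^ 2 = euclNorm x ^ 2 - 2 * ∑ i, x i * y i + euclNorm y ^ 2 := by
  simp only [euclNorm_sq, Finset.mul_sum, ← Finset.sum_sub_distrib, ← Finset.sum_add_distrib]
  exact Finset.sum_congr rfl fun i _ => by simp only [Pi.sub_apply]; ring

theorem euclNorm_pos {N : ℕ} {x : Fin N → ℝ} {i : Fin N} (hi : x i ≠ 0) : 0 < euclNorm x :=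
  Real.sqrt_pos.2 (Finset.sum_pos' (fun _ _ => sq_nonneg _) ⟨i, Finset.mem_univ i, by positivity⟩)

theorem abs_sign_mul_max (t lam : ℝ) (hlam : 0 < lam) :
    |Real.sign t * max (|t| - lam) 0| = max (|t| - lam) 0 := by
  rcases eq_or_ne t 0 with rfl | ht
  · simp [hlam.le]
  · have h : |Real.sign t| = 1 := by
      rcases Real.sign_apply_eq_of_ne_zero t ht with h | h <;> simp [h]
    rw [abs_mul, h, one_mul, abs_of_nonneg (le_max_right _ _)]

/-- Pairing `w` with `t` beyond the threshold is bounded by the soft-thresholding of `t`. -/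
theorem mul_sub_le_abs_mul_abs_softThreshold (w t lam : ℝ) (hlam : 0 < lam) :
    w * t - lam * |w| ≤ |w| * |Real.sign t * max (|t| - lam) 0| := by
  rw [abs_sign_mul_max t lam hlam]
  have h₁ : w * t ≤ |w| * |t| := by rw [← abs_mul]; exact le_abs_self _
  have h₂ := mul_le_mul_of_nonneg_left (le_max_left (|t| - lam) 0) (abs_nonneg w)
  linarith

/-- The soft-thresholding of `t` attains the bound on the pairing with `t`. -/
theorem softThreshold_mul_sub (t lam : ℝ) (hlam : 0 < lam) :
    Real.sign t * max (|t| - lam) 0 * t - lam * |Real.sign t * max (|t| - lam) 0| =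
      (Real.sign t * max (|t| - lam) 0) ^ 2 := by
  rw [← sq_abs (Real.sign t * _), abs_sign_mul_max t lam hlam]
  have h : Real.sign t * t = |t| := by
    rcases lt_trichotomy t 0 with h | rfl | h
    · simp [Real.sign_of_neg h, abs_of_neg h]
    · simp
    · simp [Real.sign_of_pos h, abs_of_pos h]
  have h' : max (|t| - lam) 0 * (|t| - lam) = max (|t| - lam) 0 ^ 2 := by
    rcases max_cases (|t| - lam) 0 with ⟨h, _⟩ | ⟨h, _⟩ <;> rw [h] <;> ring
  linear_combination max (|t| - lam) 0 * h + h'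

/-- **Proximal operator of ℓ₁−ℓ₂, large-coefficient case.** If `‖y‖_∞ > λ > 0` and
`z = prox_{ℓ1}(y; λ)` is the soft-thresholding of `y`, then
`c* = z(‖z‖₂ + λ)/‖z‖₂` minimizes `c ↦ λ(‖c‖₁ − ‖c‖₂) + ½‖c − y‖₂²`. -/
theorem l1_minus_l2_prox_large
    (N : ℕ) (lam : ℝ) (hlam : 0 < lam) (y : Fin N → ℝ)
    (hinf : lam < ⨆ i, |y i|)
    (z : Fin N → ℝ)
    (hz : z = fun i => Real.sign (y i) * max (|y i| - lam) 0)
    (c : Fin N → ℝ)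
    (hc : c = ((euclNorm z + lam) / euclNorm z) • z) :
    ∀ w : Fin N → ℝ,
      lam * ((∑ i, |c i|) - euclNorm c) + (1 / 2) * (euclNorm (c - y)) ^ 2 ≤
        lam * ((∑ i, |w i|) - euclNorm w) + (1 / 2) * (euclNorm (w - y)) ^ 2 := by
  intro w
  obtain ⟨i, hi⟩ : ∃ i, lam < |y i| := by
    by_contra! h
    exact hinf.not_ge (Real.iSup_le h hlam.le)
  have hzi : z i ≠ 0 := by
    rw [← abs_pos, hz, abs_sign_mul_max _ _ hlam]
    exact lt_max_of_lt_left (sub_pos.2 hi)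
  have hzpos : 0 < euclNorm z := euclNorm_pos hzi
  have hlow : (∑ i, w i * y i) - lam * ∑ i, |w i| ≤ euclNorm w * euclNorm z := by
    calc (∑ i, w i * y i) - lam * ∑ i, |w i| ≤ ∑ i, |w i| * |z i| := by
          rw [Finset.mul_sum, ← Finset.sum_sub_distrib]
          refine Finset.sum_le_sum fun i _ => ?_
          rw [hz]
          exact mul_sub_le_abs_mul_abs_softThreshold _ _ _ hlam
      _ ≤ euclNorm w * euclNorm z := by
          simpa [euclNorm] using
            Real.sum_mul_le_sqrt_mul_sqrt Finset.univ (fun i => |w i|) (fun i => |z i|)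
  set k := (euclNorm z + lam) / euclNorm z with hk
  have hk0 : 0 ≤ k := by positivity
  have hkz : k * euclNorm z = euclNorm z + lam := div_mul_cancel₀ _ hzpos.ne'
  have hcn : euclNorm c = euclNorm z + lam := by rw [hc, euclNorm_smul hk0, hkz]
  have hatt : (∑ i, c i * y i) - lam * ∑ i, |c i| = (euclNorm z + lam) * euclNorm z := by
    calc (∑ i, c i * y i) - lam * ∑ i, |c i| = k * euclNorm z ^ 2 := by
          rw [euclNorm_sq, Finset.mul_sum, Finset.mul_sum, ← Finset.sum_sub_distrib]
          refine Finset.sum_congr rfl fun i _ => ?_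
          have h := softThreshold_mul_sub (y i) lam hlam
          have hzi : z i = Real.sign (y i) * max (|y i| - lam) 0 := by rw [hz]
          rw [← hzi] at h
          rw [hc, Pi.smul_apply, smul_eq_mul, abs_mul, abs_of_nonneg hk0]
          linear_combination k * h
      _ = (euclNorm z + lam) * euclNorm z := by rw [← hkz]; ring
  rw [euclNorm_sub_sq, euclNorm_sub_sq, hcn]
  nlinarith [sq_nonneg (euclNorm w - (euclNorm z + lam))]
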